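/- There is a constant C such that for every w ∈ C_0^∞(ℝ_+×ℝ³), every t ≥ 0 and every x ∈ ℝ³: ⟨r⟩^{1/2} |w(t,x)| ≤ C Σ_{|α|≤1} ‖Z^α ∂w(t,·)‖_{L²(ℝ³)}. -/

import Mathlib

open MeasureTheory

noncomputable section

/-- The partial derivative in the `i`-th coordinate direction on `ℝⁿ`. -/
def pd {n : ℕ} (i : Fin n) (u : (Fin n → ℝ) → ℝ) : (Fin n → ℝ) → ℝ :=
  fun z => fderiv ℝ u z (Pi.single i 1)

/-- Iterated application of a family of first-order operators along a list of indices. -/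
def opIter {α γ : Type*} (F : α → γ → γ) : List α → γ → γ
  | [] => id
  | i :: L => fun u => F i (opIter F L u)

/-- The ten vector fields Γ on ℝ×ℝ³ (coordinates: `0 = t`, `1,2,3 = x`):
`∂_t, ∂_{x₁}, ∂_{x₂}, ∂_{x₃}`, the rotations `Ω_{jk} = x_j∂_k - x_k∂_j` (`1 ≤ j < k ≤ 3`)
and the boosts `Ω_{0k} = x_k∂_t + t∂_k` (`k = 1,2,3`). -/
def GammaField (i : Fin 10) (u : (Fin 4 → ℝ) → ℝ) : (Fin 4 → ℝ) → ℝ :=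
  if i.val = 0 then pd 0 u
  else if i.val = 1 then pd 1 u
  else if i.val = 2 then pd 2 u
  else if i.val = 3 then pd 3 u
  else if i.val = 4 then fun z => z 1 * pd 2 u z - z 2 * pd 1 u z
  else if i.val = 5 then fun z => z 1 * pd 3 u z - z 3 * pd 1 u z
  else if i.val = 6 then fun z => z 2 * pd 3 u z - z 3 * pd 2 u z
  else if i.val = 7 then fun z => z 1 * pd 0 u z + z 0 * pd 1 u z
  else if i.val = 8 then fun z => z 2 * pd 0 u z + z 0 * pd 2 u z
  else fun z => z 3 * pd 0 u z + z 0 * pd 3 u z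

/-- The spatial radius `r = |x|` of a space-time point. -/
def rad (z : Fin 4 → ℝ) : ℝ := Real.sqrt ((z 1)^2 + (z 2)^2 + (z 3)^2)

/-- The d'Alembertian `□ = ∂_t² - Δ` on ℝ×ℝ³. -/
def Box (u : (Fin 4 → ℝ) → ℝ) : (Fin 4 → ℝ) → ℝ :=
  fun z => pd 0 (pd 0 u) z - pd 1 (pd 1 u) z - pd 2 (pd 2 u) z - pd 3 (pd 3 u) z

/-- The `L²` norm in `x ∈ ℝ³` at fixed time `t`. -/
def L2x (f : (Fin 4 → ℝ) → ℝ) (t : ℝ) : ℝ :=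
  Real.sqrt (∫ x : Fin 3 → ℝ, (f (Fin.cons t x))^2)

/-- The seven vector fields `Z = {∂_t, ∂_x, Ω_{jk} : 1 ≤ j < k ≤ 3}`
(the first seven of the Γ fields). -/
def ZField (i : Fin 7) : ((Fin 4 → ℝ) → ℝ) → ((Fin 4 → ℝ) → ℝ) :=
  GammaField (Fin.castLE (by norm_num) i)

section WeightedSobolev

open Set
open scoped ENNReal NNReal

/-- The open unit square. -/
def unitSquare : Set (ℝ × ℝ) := Ioo 0 1 ×ˢ Ioo 0 1

lemma measurableSet_unitSquare : MeasurableSet unitSquare :=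
  measurableSet_Ioo.prod measurableSet_Ioo

instance isProbabilityMeasure_restrict_unitSquare :
    IsProbabilityMeasure ((volume : Measure (ℝ × ℝ)).restrict unitSquare) := by
  constructor
  simp [unitSquare, Measure.volume_eq_prod, Measure.prod_prod]

lemma smul_mem_unitSquare {l : ℝ} (hl : l ∈ Ioo (0 : ℝ) 1) {q : ℝ × ℝ} (hq : q ∈ unitSquare) :
    l • q ∈ unitSquare := by
  obtain ⟨⟨h1, h2⟩, h3, h4⟩ := hq
  obtain ⟨h5, h6⟩ := hl
  refine ⟨⟨?_, ?_⟩, ?_, ?_⟩ <;> simp only [Prod.smul_fst, Prod.smul_snd, smul_eq_mul]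
  · positivity
  · nlinarith
  · positivity
  · nlinarith

lemma exists_lintegral_cube_mul_fderiv_le :
    ∃ C : ℝ≥0, ∀ f : (Fin 3 → ℝ) → ℝ, ContDiff ℝ 1 f → HasCompactSupport f →
      ∫⁻ x, ‖f x‖ₑ ^ 3 * ‖fderiv ℝ f x‖ₑ ≤ C * eLpNorm (fderiv ℝ f) 2 volume ^ 4 := by
  refine ⟨(SNormLESNormFDerivOfEqConst ℝ (volume : Measure (Fin 3 → ℝ)) 2) ^ 3,
    fun f hf hc => ?_⟩
  have hS := eLpNorm_le_eLpNorm_fderiv_of_eq (μ := (volume : Measure (Fin 3 → ℝ))) (p := 2)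
    (p' := 6) hf hc (by norm_num) (by simp) (by simp; norm_num)
  have hcf : Continuous f := hf.continuous
  have hcd : Continuous (fderiv ℝ f) := hf.continuous_fderiv one_ne_zero
  have h6 : (∫⁻ x, ‖f x‖ₑ ^ 6) ^ (1 / 2 : ℝ) = eLpNorm f 6 volume ^ 3 := by
    rw [eLpNorm_eq_lintegral_rpow_enorm_toReal (by norm_num) (by norm_num)]
    simp only [ENNReal.toReal_ofNat, ENNReal.rpow_ofNat]
    rw [← ENNReal.rpow_natCast, ← ENNReal.rpow_mul]
    norm_num
  have h2 : (∫⁻ x, ‖fderiv ℝ f x‖ₑ ^ 2) ^ (1 / 2 : ℝ) = eLpNorm (fderiv ℝ f) 2 volume := by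
    rw [eLpNorm_eq_lintegral_rpow_enorm_toReal (by norm_num) (by norm_num)]
    simp only [ENNReal.toReal_ofNat, ENNReal.rpow_ofNat]
  have hH := ENNReal.lintegral_mul_norm_pow_le (μ := (volume : Measure (Fin 3 → ℝ)))
    (f := fun x => ‖f x‖ₑ ^ 6) (g := fun x => ‖fderiv ℝ f x‖ₑ ^ 2)
    (by fun_prop) (by fun_prop) (p := 1 / 2) (q := 1 / 2) (by norm_num) (by norm_num) (by norm_num)
  rw [h6, h2] at hH
  calc ∫⁻ x, ‖f x‖ₑ ^ 3 * ‖fderiv ℝ f x‖ₑ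
      = ∫⁻ x, (‖f x‖ₑ ^ 6) ^ (1 / 2 : ℝ) * (‖fderiv ℝ f x‖ₑ ^ 2) ^ (1 / 2 : ℝ) := by
        refine lintegral_congr fun x => ?_
        rw [← ENNReal.rpow_natCast, ← ENNReal.rpow_natCast, ← ENNReal.rpow_natCast,
          ← ENNReal.rpow_mul, ← ENNReal.rpow_mul]
        norm_num
    _ ≤ _ := hH
    _ ≤ _ := by
        have : eLpNorm f 6 volume ≤ _ := hS
        grw [this]
        push_cast
        exact le_of_eq (by ring)

/-- A quartic trace bound along a ray. -/
lemma enorm_pow_four_le_lintegral_ray {f : (Fin 3 → ℝ) → ℝ} (hf : ContDiff ℝ 1 f)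
    (hc : HasCompactSupport f) (p e : Fin 3 → ℝ) (he : ‖e‖ ≤ 1) (he0 : e ≠ 0) :
    ‖f p‖ₑ ^ 4 ≤
      4 * ∫⁻ ρ in Ioi (0 : ℝ), ‖f (p + ρ • e)‖ₑ ^ 3 * ‖fderiv ℝ f (p + ρ • e)‖ₑ := by
  have hline : ContDiff ℝ 1 (fun s : ℝ => p + (-s) • e) := by fun_prop
  have hemb : Topology.IsClosedEmbedding (fun s : ℝ => p + (-s) • e) :=
    ((Homeomorph.addLeft p).isClosedEmbedding.comp
      ((isClosedEmbedding_smul_left he0).comp (Homeomorph.neg ℝ).isClosedEmbedding))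
  have hu : ContDiff ℝ 1 (fun s : ℝ => f (p + (-s) • e) ^ 4) := (hf.comp hline).pow 4
  have hcu : HasCompactSupport (fun s : ℝ => f (p + (-s) • e) ^ 4) :=
    (hc.comp_isClosedEmbedding hemb).comp_left (g := fun y : ℝ => y ^ 4) (by simp)
  have h1 := hcu.enorm_le_lintegral_Ici_deriv hu 0
  have hd : ∀ s : ℝ, ‖deriv (fun s : ℝ => f (p + (-s) • e) ^ 4) s‖ₑ ≤
      4 * (‖f (p + (-s) • e)‖ₑ ^ 3 * ‖fderiv ℝ f (p + (-s) • e)‖ₑ) := by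
    intro s
    have hl : HasDerivAt (fun s : ℝ => p + (-s) • e) ((-1 : ℝ) • e) s :=
      ((hasDerivAt_neg s).smul_const e).const_add p
    have hfs := ((hf.differentiable one_ne_zero) (p + (-s) • e)).hasFDerivAt.comp_hasDerivAt s hl
    have := (hfs.pow 4).deriv
    simp only [Function.comp_def, Pi.pow_def] at this
    rw [this, enorm_mul, enorm_mul, enorm_pow, mul_assoc]
    gcongr
    · simp [← ofReal_norm]
    · refine (ContinuousLinearMap.le_opENorm _ _).trans ?_
      have : ‖(-1 : ℝ) • e‖ₑ ≤ 1 := by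
        rw [← ofReal_norm, ENNReal.ofReal_le_one]; simpa using he
      grw [this]; simp
  have h2 : ∫⁻ s in Iic (0 : ℝ), 4 * (‖f (p + (-s) • e)‖ₑ ^ 3 * ‖fderiv ℝ f (p + (-s) • e)‖ₑ) =
      ∫⁻ ρ in Ici (0 : ℝ), 4 * (‖f (p + ρ • e)‖ₑ ^ 3 * ‖fderiv ℝ f (p + ρ • e)‖ₑ) := by
    rw [← (Measure.measurePreserving_neg (volume : Measure ℝ)).setLIntegral_comp_preimage_emb
      (MeasurableEquiv.neg ℝ).measurableEmbedding]
    simp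
  have h0 : ‖f p‖ₑ ^ 4 = ‖(fun s : ℝ => f (p + (-s) • e) ^ 4) 0‖ₑ := by simp [enorm_pow]
  rw [h0, ← lintegral_const_mul' _ _ (by norm_num), setLIntegral_congr Ioi_ae_eq_Ici, ← h2]
  exact h1.trans (lintegral_mono hd)

lemma setLIntegral_unitSquare_comp_smul_le (F : ℝ × ℝ → ℝ≥0∞) {l : ℝ} (hl : l ∈ Ioo (0 : ℝ) 1) :
    ∫⁻ q in unitSquare, F (l • q) ≤ ENNReal.ofReal (l ^ (-2 : ℝ)) * ∫⁻ q in unitSquare, F q := by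
  have hl0 : l ≠ 0 := hl.1.ne'
  have hmap := Measure.map_addHaar_smul (volume : Measure (ℝ × ℝ)) hl0
  rw [← lintegral_indicator measurableSet_unitSquare,
    ← lintegral_indicator measurableSet_unitSquare]
  calc ∫⁻ q, unitSquare.indicator (fun q => F (l • q)) q
      ≤ ∫⁻ q, unitSquare.indicator F (l • q) := by
        refine lintegral_mono fun q => ?_
        by_cases hq : q ∈ unitSquare
        · have : l • q ∈ unitSquare := smul_mem_unitSquare hl hq
          simp [hq, this]
        · simp [hq]
    _ = ∫⁻ q, unitSquare.indicator F q ∂(Measure.map (l • ·) (volume : Measure (ℝ × ℝ))) := by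
        exact ((Homeomorph.smulOfNeZero l hl0).measurableEmbedding.lintegral_map _).symm
    _ ≤ _ := by
        rw [hmap, lintegral_smul_measure, smul_eq_mul]
        gcongr
        simp only [Module.finrank_prod, Module.finrank_self]
        rw [Real.rpow_neg hl.1.le, abs_of_nonneg (by have := hl.1; positivity)]
        norm_num

/-- Morrey's inequality on the unit square, at a corner, with exponent four. -/
lemma enorm_zero_le_eLpNorm_unitSquare {G g : ℝ × ℝ → ℝ} (hG : ContDiff ℝ 1 G)
    (hg : Continuous g) (hb : ∀ q ∈ unitSquare, ‖fderiv ℝ G q‖ ≤ g q) :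
    ‖G 0‖ₑ ≤ eLpNorm G 4 (volume.restrict unitSquare) +
      2 * eLpNorm g 4 (volume.restrict unitSquare) := by
  have hGc := hG.continuous
  have hpt : ∀ q ∈ unitSquare, ‖G 0‖ₑ ≤ ‖G q‖ₑ + ∫⁻ l in Ioo (0 : ℝ) 1, ‖g (l • q)‖ₑ := by
    intro q hq
    have hder : ∀ l : ℝ, HasDerivAt (fun l : ℝ => G (l • q)) (fderiv ℝ G (l • q) q) l := by
      intro l
      have hl : HasDerivAt (fun l : ℝ => l • q) ((1 : ℝ) • q) l := (hasDerivAt_id l).smul_const q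
      have := ((hG.differentiable one_ne_zero) (l • q)).hasFDerivAt.comp_hasDerivAt l hl
      rwa [one_smul] at this
    have hcont : Continuous fun l : ℝ => fderiv ℝ G (l • q) q := by
      have := hG.continuous_fderiv one_ne_zero
      fun_prop
    have hftc := intervalIntegral.integral_eq_sub_of_hasDerivAt (a := 0) (b := 1)
      (fun l _ => hder l) (hcont.intervalIntegrable _ _)
    simp only [one_smul, zero_smul] at hftc
    have h0 : G 0 = G q - ∫ l in (0 : ℝ)..1, fderiv ℝ G (l • q) q := by rw [hftc]; ring
    rw [h0]
    refine (enorm_sub_le).trans ?_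
    gcongr
    rw [intervalIntegral.integral_of_le zero_le_one, integral_Ioc_eq_integral_Ioo]
    refine (enorm_integral_le_lintegral_enorm _).trans ?_
    refine setLIntegral_mono' measurableSet_Ioo fun l hl => ?_
    have hlq : l • q ∈ unitSquare := smul_mem_unitSquare hl hq
    have hq1 : ‖q‖ ≤ 1 := by
      obtain ⟨⟨h1, h2⟩, h3, h4⟩ := hq
      rw [Prod.norm_def, Real.norm_of_nonneg h1.le, Real.norm_of_nonneg h3.le]
      exact max_le h2.le h4.le
    rw [enorm_le_iff_norm_le]
    calc ‖fderiv ℝ G (l • q) q‖ ≤ ‖fderiv ℝ G (l • q)‖ * ‖q‖ := ContinuousLinearMap.le_opNorm _ _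
      _ ≤ ‖fderiv ℝ G (l • q)‖ * 1 := by gcongr
      _ ≤ g (l • q) := by rw [mul_one]; exact hb _ hlq
      _ ≤ ‖g (l • q)‖ := le_abs_self _
  have hL1 : ∀ h : ℝ × ℝ → ℝ, Continuous h →
      ∫⁻ q in unitSquare, ‖h q‖ₑ ≤ eLpNorm h 4 (volume.restrict unitSquare) := by
    intro h hh
    rw [← eLpNorm_one_eq_lintegral_enorm]
    exact eLpNorm_le_eLpNorm_of_exponent_le (by norm_num) hh.aestronglyMeasurable
  have hscale : ∀ l ∈ Ioo (0 : ℝ) 1, ∫⁻ q in unitSquare, ‖g (l • q)‖ₑ ≤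
      ENNReal.ofReal (l ^ (-(1 / 2) : ℝ)) * eLpNorm g 4 (volume.restrict unitSquare) := by
    intro l hl
    refine (hL1 (fun q => g (l • q)) (by fun_prop)).trans ?_
    rw [eLpNorm_eq_lintegral_rpow_enorm_toReal (by norm_num) (by norm_num),
      eLpNorm_eq_lintegral_rpow_enorm_toReal (by norm_num) (by norm_num)]
    grw [setLIntegral_unitSquare_comp_smul_le (fun q => ‖g q‖ₑ ^ (4 : ℝ≥0∞).toReal) hl]
    rw [ENNReal.mul_rpow_of_nonneg _ _ (by simp), ENNReal.ofReal_rpow_of_pos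
      (Real.rpow_pos_of_pos hl.1 _), ← Real.rpow_mul hl.1.le]
    norm_num
  have htwo : ∫⁻ l in Ioo (0 : ℝ) 1, ENNReal.ofReal (l ^ (-(1 / 2) : ℝ)) = 2 := by
    have hl_int : IntervalIntegrable (fun l : ℝ => l ^ (-(1 / 2) : ℝ)) volume 0 1 :=
      intervalIntegral.intervalIntegrable_rpow' (by norm_num)
    rw [intervalIntegrable_iff_integrableOn_Ioo_of_le zero_le_one] at hl_int
    rw [← ofReal_integral_eq_lintegral_ofReal hl_int, ← integral_Ioc_eq_integral_Ioo,
      ← intervalIntegral.integral_of_le zero_le_one, integral_rpow (by norm_num)]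
    · norm_num
    · filter_upwards [ae_restrict_mem measurableSet_Ioo] with l hl
      exact Real.rpow_nonneg hl.1.le _
  calc ‖G 0‖ₑ = ∫⁻ _ in unitSquare, ‖G 0‖ₑ := by simp
    _ ≤ ∫⁻ q in unitSquare, (‖G q‖ₑ + ∫⁻ l in Ioo (0 : ℝ) 1, ‖g (l • q)‖ₑ) :=
        setLIntegral_mono' measurableSet_unitSquare hpt
    _ = (∫⁻ q in unitSquare, ‖G q‖ₑ) +
          ∫⁻ l in Ioo (0 : ℝ) 1, ∫⁻ q in unitSquare, ‖g (l • q)‖ₑ := by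
        rw [lintegral_add_left (by fun_prop), lintegral_lintegral_swap]
        exact Measurable.aemeasurable (Continuous.measurable (by fun_prop))
    _ ≤ eLpNorm G 4 (volume.restrict unitSquare) + ∫⁻ l in Ioo (0 : ℝ) 1,
          ENNReal.ofReal (l ^ (-(1 / 2) : ℝ)) * eLpNorm g 4 (volume.restrict unitSquare) :=
        add_le_add (hL1 G hGc) (setLIntegral_mono' measurableSet_Ioo hscale)
    _ = _ := by rw [lintegral_mul_const _ (by fun_prop), htwo]

lemma lintegral_fin_three {H : (Fin 3 → ℝ) → ℝ≥0∞} (hH : Measurable H) :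
    ∫⁻ y, H y = ∫⁻ z : ℝ, ∫⁻ p : ℝ × ℝ, H ![z, p.1, p.2] := by
  have h1 := (volume_preserving_piFinSuccAbove (fun _ : Fin 3 => ℝ) 0).symm
  have h2 := (volume_preserving_finTwoArrow ℝ).symm
  rw [← h1.lintegral_comp_emb (MeasurableEquiv.measurableEmbedding _), Measure.volume_eq_prod,
    lintegral_prod _ (by fun_prop)]
  refine lintegral_congr fun z => ?_
  rw [← h2.lintegral_comp_emb (MeasurableEquiv.measurableEmbedding _)]
  refine lintegral_congr fun p => ?_
  congr 1
  ext i
  fin_cases i <;> rfl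

/-- The spherical parametrization of the unit sphere, with `q.1` the longitude and `q.2` the
latitude. -/
def spherePoint (q : ℝ × ℝ) : Fin 3 → ℝ :=
  ![Real.sin q.2, Real.cos q.1 * Real.cos q.2, Real.sin q.1 * Real.cos q.2]

lemma continuous_spherePoint : Continuous spherePoint := by
  unfold spherePoint
  fun_prop

lemma sum_sq_spherePoint (q : ℝ × ℝ) : ∑ i, spherePoint q i ^ 2 = 1 := by
  simp only [spherePoint, Fin.sum_univ_three, Matrix.cons_val]
  nlinarith [Real.sin_sq_add_cos_sq q.1, Real.sin_sq_add_cos_sq q.2]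

lemma setLIntegral_Ioo_le_lintegral_polar {F : ℝ × ℝ → ℝ≥0∞} (hF : Measurable F) :
    ∫⁻ a in Ioo (0 : ℝ) 1, ∫⁻ s in Ioi (0 : ℝ),
      ENNReal.ofReal s * F (s * Real.cos a, s * Real.sin a) ≤ ∫⁻ p, F p := by
  rw [← lintegral_comp_polarCoord_symm, polarCoord_target, Measure.volume_eq_prod,
    ← Measure.prod_restrict, lintegral_prod_symm _ (by
      have := continuous_polarCoord_symm.measurable
      fun_prop)]
  refine (lintegral_mono' (Measure.restrict_mono ?_ le_rfl) le_rfl)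
  intro a ha
  have := Real.pi_gt_three
  exact ⟨by linarith [ha.1], by linarith [ha.2]⟩

lemma lintegral_sphericalSector_le {H : (Fin 3 → ℝ) → ℝ≥0∞} (hH : Measurable H) :
    ∫⁻ q in unitSquare, ∫⁻ ρ in Ioi (0 : ℝ),
      ENNReal.ofReal (ρ ^ 2 * Real.cos q.2) * H (ρ • spherePoint q) ≤ ∫⁻ y, H y := by
  have hm : Measurable fun p : (ℝ × ℝ) × ℝ => H ![p.1.2, p.1.1 * Real.cos p.2,
      p.1.1 * Real.sin p.2] := hH.comp (Continuous.measurable (by fun_prop))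
  calc ∫⁻ q in unitSquare, ∫⁻ ρ in Ioi (0 : ℝ),
        ENNReal.ofReal (ρ ^ 2 * Real.cos q.2) * H (ρ • spherePoint q)
      = ∫⁻ a in Ioo (0 : ℝ) 1, ∫⁻ b in Ioo (0 : ℝ) 1, ∫⁻ ρ in Ioi (0 : ℝ), ENNReal.ofReal ρ *
          (indicator (Ioi 0 ×ˢ univ) (fun p : ℝ × ℝ => ENNReal.ofReal p.1 *
            H ![p.2, p.1 * Real.cos a, p.1 * Real.sin a]))
              (ρ * Real.cos b, ρ * Real.sin b) := by
        rw [unitSquare, Measure.volume_eq_prod, ← Measure.prod_restrict, lintegral_prod]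
        · refine lintegral_congr fun a => setLIntegral_congr_fun measurableSet_Ioo fun b hb =>
            setLIntegral_congr_fun measurableSet_Ioi fun ρ hρ => ?_
          have hρ : 0 < ρ := hρ
          have hb : 0 < Real.cos b := Real.cos_pos_of_mem_Ioo
            ⟨by linarith [hb.1, Real.pi_gt_three], by linarith [hb.2, Real.pi_gt_three]⟩
          rw [indicator_of_mem (by simpa using by positivity), ← mul_assoc,
            ← ENNReal.ofReal_mul hρ.le]
          congr 2
          · ring
          · ext i
            fin_cases i <;> simp [spherePoint] <;> ring
        · refine Measurable.aemeasurable (Measurable.lintegral_prod_right' (f := fun p :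
            (ℝ × ℝ) × ℝ => ENNReal.ofReal (p.2 ^ 2 * Real.cos p.1.2) *
              H (p.2 • spherePoint p.1)) ?_)
          have := continuous_spherePoint
          refine Measurable.mul (by fun_prop) (hH.comp (Continuous.measurable (by fun_prop)))
    _ ≤ ∫⁻ a in Ioo (0 : ℝ) 1, ∫⁻ p, (indicator (Ioi 0 ×ˢ univ) (fun p : ℝ × ℝ =>
          ENNReal.ofReal p.1 * H ![p.2, p.1 * Real.cos a, p.1 * Real.sin a])) p := by
        refine lintegral_mono fun a => setLIntegral_Ioo_le_lintegral_polar ?_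
        refine Measurable.indicator ?_ (measurableSet_Ioi.prod MeasurableSet.univ)
        exact Measurable.mul (by fun_prop) (hm.comp (g := fun p : (ℝ × ℝ) × ℝ => H ![p.1.2,
          p.1.1 * Real.cos p.2, p.1.1 * Real.sin p.2]) (f := fun p => (p, a)) (by fun_prop))
    _ = ∫⁻ a in Ioo (0 : ℝ) 1, ∫⁻ z, ∫⁻ s in Ioi (0 : ℝ), ENNReal.ofReal s *
          H ![z, s * Real.cos a, s * Real.sin a] := by
        refine lintegral_congr fun a => ?_
        rw [lintegral_indicator (measurableSet_Ioi.prod MeasurableSet.univ),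
          Measure.volume_eq_prod, ← Measure.prod_restrict, lintegral_prod_symm,
          Measure.restrict_univ]
        exact (Measurable.mul (by fun_prop) (hm.comp (g := fun p : (ℝ × ℝ) × ℝ => H ![p.1.2,
          p.1.1 * Real.cos p.2, p.1.1 * Real.sin p.2]) (f := fun p => (p, a))
            (by fun_prop))).aemeasurable
    _ = ∫⁻ z, ∫⁻ a in Ioo (0 : ℝ) 1, ∫⁻ s in Ioi (0 : ℝ), ENNReal.ofReal s *
          H ![z, s * Real.cos a, s * Real.sin a] := by
        refine lintegral_lintegral_swap (Measurable.aemeasurable ?_)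
        refine Measurable.lintegral_prod_right' (f := fun p : (ℝ × ℝ) × ℝ =>
          ENNReal.ofReal p.2 * H ![p.1.2, p.2 * Real.cos p.1.1, p.2 * Real.sin p.1.1]) ?_
        exact Measurable.mul (by fun_prop) (hH.comp (Continuous.measurable (by fun_prop)))
    _ ≤ ∫⁻ z, ∫⁻ p : ℝ × ℝ, H ![z, p.1, p.2] := by
        refine lintegral_mono fun z => setLIntegral_Ioo_le_lintegral_polar
          (F := fun p => H ![z, p.1, p.2]) ?_
        exact hH.comp (Continuous.measurable (by fun_prop))
    _ = ∫⁻ y, H y := (lintegral_fin_three hH).symm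

lemma lintegral_sphericalChart_le {H : (Fin 3 → ℝ) → ℝ≥0∞} (hH : Measurable H) {R : ℝ}
    (hR : 0 < R) :
    ∫⁻ q in unitSquare, ∫⁻ ρ in Ioi (0 : ℝ), H ((R + ρ) • spherePoint q) ≤
      ENNReal.ofReal ((R ^ 2 * Real.cos 1)⁻¹) * ∫⁻ y, H y := by
  have hc1 : 0 < Real.cos 1 := Real.cos_one_pos
  grw [← lintegral_sphericalSector_le hH, ← lintegral_const_mul' _ _ ENNReal.ofReal_ne_top]
  refine setLIntegral_mono' measurableSet_unitSquare fun q hq => ?_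
  rw [← lintegral_const_mul' _ _ ENNReal.ofReal_ne_top]
  have hshift : ∫⁻ ρ in Ioi (0 : ℝ), H ((R + ρ) • spherePoint q) =
      ∫⁻ ρ in Ioi R, H (ρ • spherePoint q) := by
    rw [← (measurePreserving_add_left volume R).setLIntegral_comp_preimage_emb
      (measurableEmbedding_addLeft R) (fun ρ => H (ρ • spherePoint q))]
    simp
  rw [hshift]
  refine (setLIntegral_mono' measurableSet_Ioi fun ρ hρ => ?_).trans
    (lintegral_mono_set (Ioi_subset_Ioi hR.le))
  have hρ : R < ρ := hρ
  have hcos : Real.cos 1 ≤ Real.cos q.2 :=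
    Real.cos_le_cos_of_nonneg_of_le_pi hq.2.1.le (by linarith [Real.pi_gt_three]) hq.2.2.le
  rw [← mul_assoc, ← ENNReal.ofReal_mul (by positivity)]
  refine le_mul_of_one_le_left zero_le ?_
  rw [ENNReal.one_le_ofReal, inv_mul_eq_div, one_le_div (by positivity)]
  gcongr

lemma lintegral_planarChart_le {H : (Fin 3 → ℝ) → ℝ≥0∞} (hH : Measurable H) (x : Fin 3 → ℝ) :
    ∫⁻ q in unitSquare, ∫⁻ ρ in Ioi (0 : ℝ), H (x + ![0, q.1, q.2] + ρ • ![1, 0, 0]) ≤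
      ∫⁻ y, H y := by
  have hm : Measurable fun p : (ℝ × ℝ) × ℝ => H (x + ![p.2, p.1.1, p.1.2]) :=
    hH.comp (Continuous.measurable (by fun_prop))
  calc ∫⁻ q in unitSquare, ∫⁻ ρ in Ioi (0 : ℝ), H (x + ![0, q.1, q.2] + ρ • ![1, 0, 0])
      ≤ ∫⁻ q : ℝ × ℝ, ∫⁻ ρ : ℝ, H (x + ![ρ, q.1, q.2]) := by
        refine lintegral_mono' Measure.restrict_le_self fun q => ?_
        refine (setLIntegral_le_lintegral _ _).trans (le_of_eq (lintegral_congr fun ρ => ?_))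
        congr 1
        ext i
        fin_cases i <;> simp <;> rfl
    _ = ∫⁻ ρ : ℝ, ∫⁻ q : ℝ × ℝ, H (x + ![ρ, q.1, q.2]) := lintegral_lintegral_swap hm.aemeasurable
    _ = ∫⁻ y, H (x + y) :=
        (lintegral_fin_three (H := fun y => H (x + y)) (by fun_prop)).symm
    _ = ∫⁻ y, H y := lintegral_add_left_eq_self H x
    _ ≤ _ := le_rfl

/-- For every unit vector there is a linear isometry of `ℝ³` for the Euclidean structure moving the
second basis vector to it. -/
lemma exists_isometry_map_eq {u : Fin 3 → ℝ} (hu : ∑ i, u i ^ 2 = 1) :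
    ∃ O : (Fin 3 → ℝ) →L[ℝ] (Fin 3 → ℝ), MeasurePreserving O ∧ MeasurableEmbedding O ∧
      (∀ y z, ∑ i, O y i * O z i = ∑ i, y i * z i) ∧ O ![0, 1, 0] = u := by
  let e := EuclideanSpace.equiv (Fin 3) ℝ
  let a : EuclideanSpace ℝ (Fin 3) := WithLp.toLp 2 ![0, 1, 0]
  let b : EuclideanSpace ℝ (Fin 3) := WithLp.toLp 2 u
  have hab : ‖a‖ = ‖b‖ := by
    simp [EuclideanSpace.norm_eq, a, b, hu, Fin.sum_univ_three]
  let T := (ℝ ∙ (a - b))ᗮ.reflection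
  have hT : T a = b := Submodule.reflection_sub hab
  refine ⟨((e.symm.trans T.toContinuousLinearEquiv).trans e).toContinuousLinearMap, ?_, ?_, fun y z => ?_, ?_⟩
  · exact (PiLp.volume_preserving_ofLp (Fin 3)).comp
      (T.measurePreserving.comp (PiLp.volume_preserving_toLp (Fin 3)))
  · exact (e.toHomeomorph.measurableEmbedding).comp
      (T.toHomeomorph.measurableEmbedding.comp e.symm.toHomeomorph.measurableEmbedding)
  · have := T.inner_map_map (WithLp.toLp 2 z) (WithLp.toLp 2 y)
    rw [PiLp.inner_apply, PiLp.inner_apply] at this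
    simp only [RCLike.inner_apply, conj_trivial] at this
    exact this
  · exact congrArg WithLp.ofLp hT

/-- The trace on a surface of a function on `ℝ³` is bounded in `L⁴` by the gradient in `L²`, when
rays transversal to the surface foliate a region of space with density bounded below. -/
lemma exists_eLpNorm_trace_le :
    ∃ C : ℝ≥0, ∀ (p e : ℝ × ℝ → Fin 3 → ℝ) (K : ℝ≥0∞), (∀ q, ‖e q‖ ≤ 1) → (∀ q, e q ≠ 0) →
      (∀ H : (Fin 3 → ℝ) → ℝ≥0∞, Measurable H →
        ∫⁻ q in unitSquare, ∫⁻ ρ in Ioi (0 : ℝ), H (p q + ρ • e q) ≤ K * ∫⁻ y, H y) →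
      ∀ f : (Fin 3 → ℝ) → ℝ, ContDiff ℝ 1 f → HasCompactSupport f →
        eLpNorm (fun q => f (p q)) 4 (volume.restrict unitSquare) ≤
          C * K ^ (1 / 4 : ℝ) * eLpNorm (fderiv ℝ f) 2 volume := by
  obtain ⟨C, hC⟩ := exists_lintegral_cube_mul_fderiv_le
  refine ⟨(4 * C) ^ (1 / 4 : ℝ), fun p e K he he0 hK f hf hc => ?_⟩
  have hcf : Continuous f := hf.continuous
  have hcd : Continuous (fderiv ℝ f) := hf.continuous_fderiv one_ne_zero
  have h4 : ∫⁻ q in unitSquare, ‖f (p q)‖ₑ ^ (4 : ℝ) ≤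
      4 * C * K * eLpNorm (fderiv ℝ f) 2 volume ^ (4 : ℝ) := by
    simp only [ENNReal.rpow_ofNat]
    calc ∫⁻ q in unitSquare, ‖f (p q)‖ₑ ^ 4
        ≤ ∫⁻ q in unitSquare, 4 * ∫⁻ ρ in Ioi (0 : ℝ), ‖f (p q + ρ • e q)‖ₑ ^ 3 *
            ‖fderiv ℝ f (p q + ρ • e q)‖ₑ :=
          lintegral_mono fun q => enorm_pow_four_le_lintegral_ray hf hc _ _ (he q) (he0 q)
      _ = 4 * ∫⁻ q in unitSquare, ∫⁻ ρ in Ioi (0 : ℝ), ‖f (p q + ρ • e q)‖ₑ ^ 3 *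
            ‖fderiv ℝ f (p q + ρ • e q)‖ₑ := lintegral_const_mul' _ _ (by norm_num)
      _ ≤ 4 * (K * (C * eLpNorm (fderiv ℝ f) 2 volume ^ 4)) := by
          grw [hK (fun y => ‖f y‖ₑ ^ 3 * ‖fderiv ℝ f y‖ₑ) (by fun_prop), hC f hf hc]
      _ = _ := by ring
  rw [eLpNorm_eq_lintegral_rpow_enorm_toReal (by norm_num) (by norm_num)]
  simp only [ENNReal.toReal_ofNat]
  grw [h4]
  rw [ENNReal.mul_rpow_of_nonneg _ _ (by norm_num), ENNReal.mul_rpow_of_nonneg _ _ (by norm_num),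
    ← ENNReal.rpow_mul, ENNReal.coe_rpow_of_nonneg _ (by norm_num)]
  norm_num

lemma exists_enorm_le_of_chart :
    ∃ C : ℝ≥0, ∀ (p e : ℝ × ℝ → Fin 3 → ℝ) (K : ℝ≥0∞), ContDiff ℝ 1 p → (∀ q, ‖e q‖ ≤ 1) →
      (∀ q, e q ≠ 0) →
      (∀ H : (Fin 3 → ℝ) → ℝ≥0∞, Measurable H →
        ∫⁻ q in unitSquare, ∫⁻ ρ in Ioi (0 : ℝ), H (p q + ρ • e q) ≤ K * ∫⁻ y, H y) →
      ∀ (v : (Fin 3 → ℝ) → ℝ) (f : Fin 3 → (Fin 3 → ℝ) → ℝ), ContDiff ℝ 1 v →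
        HasCompactSupport v → (∀ j, ContDiff ℝ 1 (f j)) → (∀ j, HasCompactSupport (f j)) →
        (∀ q, ∀ ξ, |fderiv ℝ v (p q) (fderiv ℝ p q ξ)| ≤ 2 * ‖ξ‖ * ∑ j, |f j (p q)|) →
        ‖v (p 0)‖ₑ ≤ C * K ^ (1 / 4 : ℝ) * (eLpNorm (fderiv ℝ v) 2 volume +
          ∑ j, eLpNorm (fderiv ℝ (f j)) 2 volume) := by
  obtain ⟨C, hC⟩ := exists_eLpNorm_trace_le
  refine ⟨4 * C, fun p e K hp he he0 hK v f hv hvc hf hfc hb => ?_⟩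
  have hcf : ∀ j, Continuous (f j) := fun j => (hf j).continuous
  have hcp := hp.continuous
  have hM := enorm_zero_le_eLpNorm_unitSquare (G := fun q => v (p q))
    (g := fun q => 2 * ∑ j, |f j (p q)|) (hv.comp hp) (by fun_prop) (fun q _ => by
      refine ContinuousLinearMap.opNorm_le_bound _ (by positivity) fun ξ => ?_
      have := fderiv_comp q ((hv.differentiable one_ne_zero) (p q))
        ((hp.differentiable one_ne_zero) q)
      simp only [Function.comp_def] at this
      rw [this, ContinuousLinearMap.comp_apply, Real.norm_eq_abs]
      refine (hb q ξ).trans (le_of_eq (by ring)))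
  have hsum : eLpNorm (fun q => 2 * ∑ j, |f j (p q)|) 4 (volume.restrict unitSquare) ≤
      2 * ∑ j, C * K ^ (1 / 4 : ℝ) * eLpNorm (fderiv ℝ (f j)) 2 volume := by
    have h1 : (fun q => 2 * ∑ j, |f j (p q)|) = (2 : ℝ) • ∑ j, fun q => |f j (p q)| := by
      ext q; simp
    rw [h1, eLpNorm_const_smul]
    have h2 : ‖(2 : ℝ)‖ₑ = 2 := by simp [← ofReal_norm]
    rw [h2]
    gcongr
    refine (eLpNorm_sum_le (fun j _ => Continuous.aestronglyMeasurable (by fun_prop))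
      (by norm_num)).trans (Finset.sum_le_sum fun j _ => ?_)
    have h3 : eLpNorm (fun q => |f j (p q)|) 4 (volume.restrict unitSquare) =
      eLpNorm (fun q => f j (p q)) 4 (volume.restrict unitSquare) :=
        eLpNorm_norm (fun q => f j (p q))
    rw [h3]
    exact hC p e K he he0 hK _ (hf j) (hfc j)
  refine hM.trans ?_
  grw [hsum, hC p e K he he0 hK v hv hvc]
  rw [← Finset.mul_sum]
  push_cast
  calc _ ≤ 4 * (C * K ^ (1 / 4 : ℝ) * eLpNorm (fderiv ℝ v) 2 volume) +
        2 * (2 * (C * K ^ (1 / 4 : ℝ) * ∑ j, eLpNorm (fderiv ℝ (f j)) 2 volume)) := by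
        refine add_le_add_left ?_ _
        exact le_mul_of_one_le_left zero_le (by norm_num)
    _ = _ := by ring

lemma clm_apply_eq_sum (L : (Fin 3 → ℝ) →L[ℝ] ℝ) (y : Fin 3 → ℝ) :
    L y = ∑ i, y i * L (Pi.single i 1) := by
  conv_lhs => rw [pi_eq_sum_univ' y]
  simp [map_sum]

/-- A derivative in a direction orthogonal to `y` is controlled by the rotation fields at `y`. -/
lemma abs_clm_apply_le_of_orthogonal (L : (Fin 3 → ℝ) →L[ℝ] ℝ) {y η : Fin 3 → ℝ} {R m : ℝ}
    (hR : 0 < R) (hm : 0 ≤ m) (hy : ∑ i, y i ^ 2 = R ^ 2) (ho : ∑ i, y i * η i = 0)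
    (hη : ∑ i, η i ^ 2 ≤ (R * m) ^ 2) :
    |L η| ≤ m * (|y 0 * L (Pi.single 1 1) - y 1 * L (Pi.single 0 1)| +
      |y 0 * L (Pi.single 2 1) - y 2 * L (Pi.single 0 1)| +
      |y 1 * L (Pi.single 2 1) - y 2 * L (Pi.single 1 1)|) := by
  rw [clm_apply_eq_sum L η]
  simp only [Fin.sum_univ_three] at *
  set l0 := L (Pi.single 0 1)
  set l1 := L (Pi.single 1 1)
  set l2 := L (Pi.single 2 1)
  have hlag : (y 0 * η 1 - y 1 * η 0) ^ 2 + (y 0 * η 2 - y 2 * η 0) ^ 2 +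
      (y 1 * η 2 - y 2 * η 1) ^ 2 ≤ (R ^ 2 * m) ^ 2 := by
    calc _ = (y 0 ^ 2 + y 1 ^ 2 + y 2 ^ 2) * (η 0 ^ 2 + η 1 ^ 2 + η 2 ^ 2) -
          (y 0 * η 0 + y 1 * η 1 + y 2 * η 2) ^ 2 := by ring
      _ ≤ R ^ 2 * (R * m) ^ 2 := by rw [hy, ho]; nlinarith [sq_nonneg R]
      _ = _ := by ring
  have hc : ∀ c : ℝ, c ^ 2 ≤ (R ^ 2 * m) ^ 2 → |c| ≤ R ^ 2 * m := fun c h =>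
    abs_le_of_sq_le_sq h (by positivity)
  have h01 := hc (y 0 * η 1 - y 1 * η 0) (by nlinarith)
  have h02 := hc (y 0 * η 2 - y 2 * η 0) (by nlinarith)
  have h12 := hc (y 1 * η 2 - y 2 * η 1) (by nlinarith)
  have hid : R ^ 2 * (η 0 * l0 + η 1 * l1 + η 2 * l2) =
      (y 0 * η 1 - y 1 * η 0) * (y 0 * l1 - y 1 * l0) +
      (y 0 * η 2 - y 2 * η 0) * (y 0 * l2 - y 2 * l0) +
      (y 1 * η 2 - y 2 * η 1) * (y 1 * l2 - y 2 * l1) := by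
    rw [← hy]
    linear_combination (-(y 0 * l0 + y 1 * l1 + y 2 * l2)) * (-ho)
  have hR2 : 0 < R ^ 2 := by positivity
  refine le_of_mul_le_mul_left ?_ hR2
  calc R ^ 2 * |η 0 * l0 + η 1 * l1 + η 2 * l2|
      = |R ^ 2 * (η 0 * l0 + η 1 * l1 + η 2 * l2)| := by rw [abs_mul, abs_of_pos hR2]
    _ ≤ |y 0 * η 1 - y 1 * η 0| * |y 0 * l1 - y 1 * l0| +
        |y 0 * η 2 - y 2 * η 0| * |y 0 * l2 - y 2 * l0| +
        |y 1 * η 2 - y 2 * η 1| * |y 1 * l2 - y 2 * l1| := by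
        rw [hid, ← abs_mul, ← abs_mul, ← abs_mul]
        exact abs_add_three _ _ _
    _ ≤ R ^ 2 * m * |y 0 * l1 - y 1 * l0| + R ^ 2 * m * |y 0 * l2 - y 2 * l0| +
        R ^ 2 * m * |y 1 * l2 - y 2 * l1| := by gcongr
    _ = _ := by ring

lemma hasFDerivAt_spherePoint (q : ℝ × ℝ) :
    ∃ S : ℝ × ℝ →L[ℝ] (Fin 3 → ℝ), HasFDerivAt spherePoint S q ∧ ∀ ξ : ℝ × ℝ,
      S ξ = ![Real.cos q.2 * ξ.2,
        -(Real.sin q.1 * Real.cos q.2 * ξ.1) - Real.cos q.1 * Real.sin q.2 * ξ.2,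
        Real.cos q.1 * Real.cos q.2 * ξ.1 - Real.sin q.1 * Real.sin q.2 * ξ.2] := by
  have h1 : HasFDerivAt (fun q : ℝ × ℝ => q.1) (ContinuousLinearMap.fst ℝ ℝ ℝ) q := hasFDerivAt_fst
  have h2 : HasFDerivAt (fun q : ℝ × ℝ => q.2) (ContinuousLinearMap.snd ℝ ℝ ℝ) q := hasFDerivAt_snd
  refine ⟨ContinuousLinearMap.pi ![Real.cos q.2 • ContinuousLinearMap.snd ℝ ℝ ℝ,
    Real.cos q.1 • (-Real.sin q.2 • ContinuousLinearMap.snd ℝ ℝ ℝ) +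
      Real.cos q.2 • (-Real.sin q.1 • ContinuousLinearMap.fst ℝ ℝ ℝ),
    Real.sin q.1 • (-Real.sin q.2 • ContinuousLinearMap.snd ℝ ℝ ℝ) +
      Real.cos q.2 • (Real.cos q.1 • ContinuousLinearMap.fst ℝ ℝ ℝ)], ?_, fun ξ => ?_⟩
  · refine hasFDerivAt_pi.2 fun i => ?_
    fin_cases i
    · exact h2.sin
    · exact h1.cos.mul h2.cos
    · exact h1.sin.mul h2.cos
  · ext i
    fin_cases i <;> simp <;> ring

lemma contDiff_spherePoint : ContDiff ℝ 1 spherePoint := by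
  refine contDiff_pi.2 fun i => ?_
  fin_cases i
  · exact Real.contDiff_sin.comp contDiff_snd
  · exact (Real.contDiff_cos.comp contDiff_fst).mul (Real.contDiff_cos.comp contDiff_snd)
  · exact (Real.contDiff_sin.comp contDiff_fst).mul (Real.contDiff_cos.comp contDiff_snd)

lemma exists_enorm_le_planar :
    ∃ C : ℝ≥0, ∀ (v : (Fin 3 → ℝ) → ℝ) (f : Fin 3 → (Fin 3 → ℝ) → ℝ), ContDiff ℝ 1 v →
      HasCompactSupport v → (∀ j, ContDiff ℝ 1 (f j)) → (∀ j, HasCompactSupport (f j)) →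
      (∀ j x, f j x = fderiv ℝ v x (Pi.single j 1)) → ∀ x,
        ‖v x‖ₑ ≤ C * (eLpNorm (fderiv ℝ v) 2 volume +
          ∑ j, eLpNorm (fderiv ℝ (f j)) 2 volume) := by
  obtain ⟨C, hC⟩ := exists_enorm_le_of_chart
  refine ⟨C, fun v f hv hvc hf hfc hfv x => ?_⟩
  have hder : ∀ q : ℝ × ℝ, ∃ S : ℝ × ℝ →L[ℝ] (Fin 3 → ℝ),
      HasFDerivAt (fun q : ℝ × ℝ => x + ![0, q.1, q.2]) S q ∧
        ∀ ξ : ℝ × ℝ, S ξ = ![0, ξ.1, ξ.2] := by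
    intro q
    refine ⟨ContinuousLinearMap.pi ![0, ContinuousLinearMap.fst ℝ ℝ ℝ,
      ContinuousLinearMap.snd ℝ ℝ ℝ], ?_, fun ξ => ?_⟩
    · refine HasFDerivAt.const_add x (hasFDerivAt_pi.2 fun i => ?_)
      fin_cases i
      · exact hasFDerivAt_const _ _
      · exact hasFDerivAt_fst
      · exact hasFDerivAt_snd
    · ext i
      fin_cases i <;> rfl
  have hcd : ContDiff ℝ 1 (fun q : ℝ × ℝ => x + ![0, q.1, q.2]) := by
    refine contDiff_const.add (contDiff_pi.2 fun i => ?_)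
    fin_cases i
    · exact contDiff_const
    · exact contDiff_fst
    · exact contDiff_snd
  have h := hC (fun q => x + ![0, q.1, q.2]) (fun _ => ![1, 0, 0]) 1 hcd
    (fun q => (pi_norm_le_iff_of_nonneg zero_le_one).2 fun i => by fin_cases i <;> simp)
    (fun q h0 => by simpa using congrFun h0 0)
    (fun H hH => by rw [one_mul]; exact lintegral_planarChart_le hH x) v f hv hvc hf hfc
    (fun q ξ => by
      obtain ⟨S, hS, hSξ⟩ := hder q
      rw [hS.fderiv, hSξ, clm_apply_eq_sum]
      simp only [← hfv, Fin.sum_univ_three, Matrix.cons_val, zero_mul, zero_add]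
      set y := x + ![0, q.1, q.2]
      have h1 : |ξ.1| ≤ ‖ξ‖ := norm_fst_le ξ
      have h2 : |ξ.2| ≤ ‖ξ‖ := norm_snd_le ξ
      have h3 := norm_nonneg ξ
      calc |ξ.1 * f 1 y + ξ.2 * f 2 y| ≤ |ξ.1| * |f 1 y| + |ξ.2| * |f 2 y| := by
            rw [← abs_mul, ← abs_mul]; exact abs_add_le _ _
        _ ≤ ‖ξ‖ * |f 1 y| + ‖ξ‖ * |f 2 y| := by gcongr
        _ ≤ _ := by nlinarith [abs_nonneg (f 0 y), abs_nonneg (f 1 y), abs_nonneg (f 2 y),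
            mul_nonneg h3 (abs_nonneg (f 0 y)), mul_nonneg h3 (abs_nonneg (f 1 y)),
            mul_nonneg h3 (abs_nonneg (f 2 y))])
  have hx : x + ![0, (0 : ℝ × ℝ).1, (0 : ℝ × ℝ).2] = x := by
    ext i
    fin_cases i <;> simp
  rwa [hx, ENNReal.one_rpow, mul_one] at h

lemma exists_enorm_le_spherical :
    ∃ C : ℝ≥0, ∀ (v : (Fin 3 → ℝ) → ℝ) (f : Fin 3 → (Fin 3 → ℝ) → ℝ), ContDiff ℝ 1 v →
      HasCompactSupport v → (∀ j, ContDiff ℝ 1 (f j)) → (∀ j, HasCompactSupport (f j)) →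
      (∀ x, f 0 x = x 0 * fderiv ℝ v x (Pi.single 1 1) - x 1 * fderiv ℝ v x (Pi.single 0 1)) →
      (∀ x, f 1 x = x 0 * fderiv ℝ v x (Pi.single 2 1) - x 2 * fderiv ℝ v x (Pi.single 0 1)) →
      (∀ x, f 2 x = x 1 * fderiv ℝ v x (Pi.single 2 1) - x 2 * fderiv ℝ v x (Pi.single 1 1)) →
      ∀ (x : Fin 3 → ℝ) (R : ℝ), 0 < R → ∑ i, x i ^ 2 = R ^ 2 →
        ‖v x‖ₑ ≤ C * ENNReal.ofReal ((R ^ 2 * Real.cos 1)⁻¹) ^ (1 / 4 : ℝ) *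
          (eLpNorm (fderiv ℝ v) 2 volume + ∑ j, eLpNorm (fderiv ℝ (f j)) 2 volume) := by
  obtain ⟨C, hC⟩ := exists_enorm_le_of_chart
  refine ⟨C, fun v f hv hvc hf hfc hf0 hf1 hf2 x R hR hx => ?_⟩
  obtain ⟨O, hOm, hOe, hOi, hOx⟩ := exists_isometry_map_eq (u := R⁻¹ • x) (by
    simp only [Pi.smul_apply, smul_eq_mul, mul_pow, ← Finset.mul_sum, hx]
    field_simp)
  have hOsq : ∀ y, ∑ i, O y i ^ 2 = ∑ i, y i ^ 2 := fun y => by simpa [sq] using hOi y y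
  have hOs : ∀ q, ∑ i, O (spherePoint q) i ^ 2 = 1 := fun q => by
    rw [hOsq, sum_sq_spherePoint]
  have h := hC (fun q => R • O (spherePoint q)) (fun q => O (spherePoint q))
    (ENNReal.ofReal ((R ^ 2 * Real.cos 1)⁻¹))
    ((O.contDiff.comp contDiff_spherePoint).const_smul R)
    (fun q => (pi_norm_le_iff_of_nonneg zero_le_one).2 fun i => by
      rw [Real.norm_eq_abs, ← sq_le_one_iff_abs_le_one, ← hOs q]
      exact Finset.single_le_sum (f := fun i => O (spherePoint q) i ^ 2)
        (fun i _ => sq_nonneg _) (Finset.mem_univ i))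
    (fun q h0 => by simpa [h0] using hOs q)
    (fun H hH => by
      have := lintegral_sphericalChart_le (H := fun y => H (O y)) (hH.comp hOm.measurable) hR
      rw [hOm.lintegral_comp_emb hOe] at this
      simpa [add_smul] using this) v f hv hvc hf hfc
    (fun q ξ => by
      obtain ⟨S, hS, hSξ⟩ := hasFDerivAt_spherePoint q
      have hp : HasFDerivAt (fun q => R • O (spherePoint q)) (R • (O ∘L S)) q :=
        (O.hasFDerivAt.comp q hS).const_smul R
      have h1 : ξ.1 ^ 2 ≤ ‖ξ‖ ^ 2 := by
        rw [← sq_abs ξ.1]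
        gcongr
        exact norm_fst_le ξ
      have h2 : ξ.2 ^ 2 ≤ ‖ξ‖ ^ 2 := by
        rw [← sq_abs ξ.2]
        gcongr
        exact norm_snd_le ξ
      have hSsq : ∑ i, S ξ i ^ 2 = Real.cos q.2 ^ 2 * ξ.1 ^ 2 + ξ.2 ^ 2 := by
        rw [hSξ]
        simp only [Fin.sum_univ_three, Matrix.cons_val]
        linear_combination (Real.cos q.2 ^ 2 * ξ.1 ^ 2 + Real.sin q.2 ^ 2 * ξ.2 ^ 2) *
          Real.sin_sq_add_cos_sq q.1 + ξ.2 ^ 2 * Real.sin_sq_add_cos_sq q.2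
      have hSo : ∑ i, spherePoint q i * S ξ i = 0 := by
        rw [hSξ]
        simp only [spherePoint, Fin.sum_univ_three, Matrix.cons_val]
        linear_combination (-(Real.sin q.2 * Real.cos q.2 * ξ.2)) * Real.sin_sq_add_cos_sq q.1
      have hgoal := abs_clm_apply_le_of_orthogonal (fderiv ℝ v (R • O (spherePoint q)))
        (y := R • O (spherePoint q)) (η := R • O (S ξ)) (m := 2 * ‖ξ‖) hR (by positivity)
        (by simp only [Pi.smul_apply, smul_eq_mul, mul_pow, ← Finset.mul_sum, hOs, mul_one])
        (by
          have : ∀ i, (R • O (spherePoint q)) i * (R • O (S ξ)) i =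
              R ^ 2 * (O (spherePoint q) i * O (S ξ) i) := fun i => by
            simp only [Pi.smul_apply, smul_eq_mul]; ring
          simp only [this, ← Finset.mul_sum, hOi, hSo, mul_zero])
        (by
          simp only [Pi.smul_apply, smul_eq_mul, mul_pow, ← Finset.mul_sum, hOsq, hSsq]
          gcongr
          nlinarith [Real.sin_sq_add_cos_sq q.2, sq_nonneg (Real.sin q.2), sq_nonneg ξ.1,
            mul_nonneg (sq_nonneg (Real.sin q.2)) (sq_nonneg ξ.1), sq_nonneg ‖ξ‖])
      rw [hp.fderiv, Fin.sum_univ_three, hf0, hf1, hf2]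
      exact hgoal)
  have h0 : R • O (spherePoint 0) = x := by
    have : spherePoint 0 = ![0, 1, 0] := by
      ext i
      fin_cases i <;> simp [spherePoint]
    rw [this, hOx, smul_inv_smul₀ hR.ne']
  rwa [h0] at h

/-- Smooth functions with compact support on `ℝⁿ`. -/
structure IsTestFunction {n : ℕ} (u : (Fin n → ℝ) → ℝ) : Prop where
  contDiff : ContDiff ℝ (⊤ : ℕ∞) u
  hasCompactSupport : HasCompactSupport u

namespace IsTestFunction

variable {n : ℕ} {u v : (Fin n → ℝ) → ℝ}

lemma differentiable (hu : IsTestFunction u) : Differentiable ℝ u :=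
  hu.contDiff.differentiable (by simp)

lemma pd (hu : IsTestFunction u) (i : Fin n) : IsTestFunction (pd i u) where
  contDiff := (hu.contDiff.fderiv_right (m := (⊤ : ℕ∞)) (by simp)).clm_apply contDiff_const
  hasCompactSupport := hu.hasCompactSupport.fderiv_apply ℝ _

lemma sub (hu : IsTestFunction u) (hv : IsTestFunction v) :
    IsTestFunction (fun z => u z - v z) where
  contDiff := hu.contDiff.sub hv.contDiff
  hasCompactSupport := hu.hasCompactSupport.sub hv.hasCompactSupport

lemma coord_mul (hu : IsTestFunction u) (i : Fin n) : IsTestFunction (fun z => z i * u z) where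
  contDiff := (contDiff_apply ℝ ℝ i).mul hu.contDiff
  hasCompactSupport := hu.hasCompactSupport.mul_left

end IsTestFunction

/-- The rotation field `z_j ∂_k - z_k ∂_j`. -/
def rotField {n : ℕ} (j k : Fin n) (u : (Fin n → ℝ) → ℝ) : (Fin n → ℝ) → ℝ :=
  fun z => z j * pd k u z - z k * pd j u z

lemma IsTestFunction.rotField {n : ℕ} {u : (Fin n → ℝ) → ℝ} (hu : IsTestFunction u)
    (j k : Fin n) : IsTestFunction (rotField j k u) :=
  ((hu.pd k).coord_mul j).sub ((hu.pd j).coord_mul k)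

lemma pd_comm {n : ℕ} {u : (Fin n → ℝ) → ℝ} (hu : IsTestFunction u) (i k : Fin n) :
    pd i (pd k u) = pd k (pd i u) := by
  have hd : Differentiable ℝ (fderiv ℝ u) :=
    (hu.contDiff.fderiv_right (m := (⊤ : ℕ∞)) (by simp)).differentiable (by simp)
  have hval : ∀ (a b : Fin n) (z : Fin n → ℝ), pd a (pd b u) z =
      fderiv ℝ (fderiv ℝ u) z (Pi.single a 1) (Pi.single b 1) := by
    intro a b z
    have := (hd z).hasFDerivAt.clm_apply (hasFDerivAt_const (Pi.single b (1 : ℝ)) z)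
    unfold pd
    rw [this.fderiv]
    simp
  ext z
  rw [hval, hval]
  exact (hu.contDiff.contDiffAt.isSymmSndFDerivAt
    (by simpa using WithTop.coe_le_coe.2 (le_top : (2 : ℕ∞) ≤ ⊤))).eq _ _

lemma pd_coord_mul {n : ℕ} {u : (Fin n → ℝ) → ℝ} (hu : IsTestFunction u) (i j : Fin n)
    (z : Fin n → ℝ) :
    pd i (fun z => z j * u z) z = z j * pd i u z + u z * (Pi.single i (1 : ℝ) : Fin n → ℝ) j := by
  have h := (hasFDerivAt_apply (𝕜 := ℝ) j z).mul (hu.differentiable z).hasFDerivAt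
  have h' : fderiv ℝ (fun z : Fin n → ℝ => z j * u z) z = _ := h.fderiv
  unfold pd
  rw [h']
  simp

lemma abs_pd_rotField_le {n : ℕ} {u : (Fin n → ℝ) → ℝ} (hu : IsTestFunction u)
    (i j k : Fin n) (z : Fin n → ℝ) :
    |pd i (rotField j k u) z| ≤ |rotField j k (pd i u) z| + |pd k u z| + |pd j u z| := by
  have hsub : pd i (rotField j k u) z =
      pd i (fun z => z j * pd k u z) z - pd i (fun z => z k * pd j u z) z := by
    have h := (((hu.pd k).coord_mul j).differentiable z).hasFDerivAt.sub
      (((hu.pd j).coord_mul k).differentiable z).hasFDerivAt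
    exact congrArg (fun L => L (Pi.single i 1)) h.fderiv
  have hsingle : ∀ m : Fin n, |(Pi.single i (1 : ℝ) : Fin n → ℝ) m| ≤ 1 := fun m => by
    by_cases h : m = i
    · subst h; simp
    · simp [h]
  rw [hsub, pd_coord_mul (hu.pd k), pd_coord_mul (hu.pd j), pd_comm hu i k, pd_comm hu i j]
  set a := (Pi.single i (1 : ℝ) : Fin n → ℝ) j
  set b := (Pi.single i (1 : ℝ) : Fin n → ℝ) k
  have ha : |pd k u z * a| ≤ |pd k u z| := by
    rw [abs_mul]; exact mul_le_of_le_one_right (abs_nonneg _) (hsingle j)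
  have hb : |-(pd j u z * b)| ≤ |pd j u z| := by
    rw [abs_neg, abs_mul]; exact mul_le_of_le_one_right (abs_nonneg _) (hsingle k)
  calc _ = |rotField j k (pd i u) z + pd k u z * a + -(pd j u z * b)| := by
        unfold rotField; congr 1; ring
    _ ≤ _ := (abs_add_three _ _ _).trans (by gcongr)

lemma hasFDerivAt_cons (t : ℝ) (x : Fin 3 → ℝ) :
    ∃ L : (Fin 3 → ℝ) →L[ℝ] (Fin 4 → ℝ),
      HasFDerivAt (fun x : Fin 3 → ℝ => (Fin.cons t x : Fin 4 → ℝ)) L x ∧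
        ∀ i : Fin 3, L (Pi.single i 1) = Pi.single i.succ 1 := by
  refine ⟨ContinuousLinearMap.pi
    (Fin.cons 0 fun i : Fin 3 => ContinuousLinearMap.proj i : Fin 4 → _), ?_, fun i => ?_⟩
  · refine hasFDerivAt_pi.2 fun i => ?_
    refine Fin.cases ?_ (fun i => ?_) i
    · exact hasFDerivAt_const t x
    · exact hasFDerivAt_apply i x
  · ext j
    refine Fin.cases ?_ (fun j => ?_) j
    · simp
    · simp [Pi.single_apply, Fin.succ_inj]

lemma IsTestFunction.slice {f : (Fin 4 → ℝ) → ℝ} (hf : IsTestFunction f) (t : ℝ) :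
    IsTestFunction (fun x : Fin 3 → ℝ => f (Fin.cons t x)) where
  contDiff := by
    refine hf.contDiff.comp (contDiff_pi.2 fun i => ?_)
    refine Fin.cases ?_ (fun i => ?_) i
    · exact contDiff_const
    · exact contDiff_apply ℝ ℝ i
  hasCompactSupport := by
    refine hf.hasCompactSupport.comp_isClosedEmbedding
      (g := fun x : Fin 3 → ℝ => (Fin.cons t x : Fin 4 → ℝ)) ?_
    refine Function.LeftInverse.isClosedEmbedding (f := fun (z : Fin 4 → ℝ) (i : Fin 3) => z i.succ)
      (fun _ => rfl) ?_ ?_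
    · exact continuous_pi fun i => continuous_apply i.succ
    · exact continuous_const.finCons continuous_id

lemma fderiv_slice {f : (Fin 4 → ℝ) → ℝ} (hf : IsTestFunction f) (t : ℝ) (x : Fin 3 → ℝ)
    (i : Fin 3) :
    fderiv ℝ (fun x : Fin 3 → ℝ => f (Fin.cons t x)) x (Pi.single i 1) =
      pd i.succ f (Fin.cons t x) := by
  obtain ⟨L, hL, hLi⟩ := hasFDerivAt_cons t x
  have h := (hf.differentiable (Fin.cons t x)).hasFDerivAt.comp x hL
  have h' : fderiv ℝ (fun x : Fin 3 → ℝ => f (Fin.cons t x)) x = _ := h.fderiv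
  rw [h', ContinuousLinearMap.comp_apply, hLi, pd]

lemma eLpNorm_slice {f : (Fin 4 → ℝ) → ℝ} (hf : IsTestFunction f) (t : ℝ) :
    eLpNorm (fun x : Fin 3 → ℝ => f (Fin.cons t x)) 2 volume = ENNReal.ofReal (L2x f t) := by
  have hs := hf.slice t
  have hm : MemLp (fun x : Fin 3 → ℝ => f (Fin.cons t x)) 2 volume :=
    hs.contDiff.continuous.memLp_of_hasCompactSupport hs.hasCompactSupport
  rw [hm.eLpNorm_eq_integral_rpow_norm (by norm_num) (by norm_num), L2x, Real.sqrt_eq_rpow]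
  simp

lemma L2x_nonneg (f : (Fin 4 → ℝ) → ℝ) (t : ℝ) : 0 ≤ L2x f t := Real.sqrt_nonneg _

lemma eLpNorm_fderiv_slice_le {f : (Fin 4 → ℝ) → ℝ} (hf : IsTestFunction f) {t M : ℝ}
    (hM : ∀ i : Fin 3, L2x (pd i.succ f) t ≤ M) :
    eLpNorm (fderiv ℝ fun x : Fin 3 → ℝ => f (Fin.cons t x)) 2 volume ≤
      3 * ENNReal.ofReal M := by
  have hcont : ∀ i : Fin 3, Continuous fun x : Fin 3 → ℝ => pd i.succ f (Fin.cons t x) :=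
    fun i => ((hf.pd i.succ).slice t).contDiff.continuous
  have hpt : ∀ x, ‖fderiv ℝ (fun x : Fin 3 → ℝ => f (Fin.cons t x)) x‖ ≤
      (∑ i : Fin 3, fun x : Fin 3 → ℝ => ‖pd i.succ f (Fin.cons t x)‖) x := by
    intro x
    refine ContinuousLinearMap.opNorm_le_bound _ (by
      rw [Finset.sum_apply]; positivity) fun y => ?_
    rw [clm_apply_eq_sum, Finset.sum_apply, Finset.sum_mul]
    refine (norm_sum_le _ _).trans (Finset.sum_le_sum fun i _ => ?_)
    rw [fderiv_slice hf, norm_mul, mul_comm]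
    gcongr
    exact norm_le_pi_norm y i
  refine (eLpNorm_mono_real hpt).trans ((eLpNorm_sum_le
    (fun i _ => (hcont i).norm.aestronglyMeasurable) (by norm_num)).trans ?_)
  refine (Finset.sum_le_card_nsmul _ _ (ENNReal.ofReal M) fun i _ => ?_).trans (by simp)
  rw [eLpNorm_norm, eLpNorm_slice (hf.pd i.succ)]
  exact ENNReal.ofReal_le_ofReal (hM i)

lemma L2x_le_add {f g₁ g₂ g₃ : (Fin 4 → ℝ) → ℝ} (hf : IsTestFunction f) (h₁ : IsTestFunction g₁)
    (h₂ : IsTestFunction g₂) (h₃ : IsTestFunction g₃)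
    (h : ∀ z, |f z| ≤ |g₁ z| + |g₂ z| + |g₃ z|) (t : ℝ) :
    L2x f t ≤ L2x g₁ t + L2x g₂ t + L2x g₃ t := by
  have c₁ := (h₁.slice t).contDiff.continuous.norm.aestronglyMeasurable (μ := volume)
  have c₂ := (h₂.slice t).contDiff.continuous.norm.aestronglyMeasurable (μ := volume)
  have c₃ := (h₃.slice t).contDiff.continuous.norm.aestronglyMeasurable (μ := volume)
  have n₁ := L2x_nonneg g₁ t
  have n₂ := L2x_nonneg g₂ t
  have n₃ := L2x_nonneg g₃ t
  rw [← ENNReal.ofReal_le_ofReal_iff (by positivity), ENNReal.ofReal_add (by positivity) n₃,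
    ENNReal.ofReal_add n₁ n₂, ← eLpNorm_slice hf, ← eLpNorm_slice h₁, ← eLpNorm_slice h₂,
    ← eLpNorm_slice h₃]
  calc _ ≤ eLpNorm ((fun x : Fin 3 → ℝ => ‖g₁ (Fin.cons t x)‖) +
        (fun x : Fin 3 → ℝ => ‖g₂ (Fin.cons t x)‖) +
        fun x : Fin 3 → ℝ => ‖g₃ (Fin.cons t x)‖) 2 volume := eLpNorm_mono_real fun x => h _
    _ ≤ _ := by
        refine (eLpNorm_add_le (c₁.add c₂) c₃ (by norm_num)).trans ?_
        grw [eLpNorm_add_le c₁ c₂ (by norm_num)]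
        simp only [eLpNorm_norm, le_refl]

/-- The sum of the `L²` norms of `Z^α ∂w` over `|α| ≤ 1`. -/
def energySum (w : (Fin 4 → ℝ) → ℝ) (t : ℝ) : ℝ :=
  ∑ n ∈ Finset.range 2, ∑ σ : Fin n → Fin 7, ∑ i : Fin 4,
    L2x (opIter ZField (List.ofFn σ) (pd i w)) t

lemma L2x_opIter_le_energySum (w : (Fin 4 → ℝ) → ℝ) (t : ℝ) {n : ℕ} (hn : n < 2)
    (σ : Fin n → Fin 7) (i : Fin 4) :
    L2x (opIter ZField (List.ofFn σ) (pd i w)) t ≤ energySum w t := by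
  have h1 := Finset.single_le_sum (f := fun i => L2x (opIter ZField (List.ofFn σ) (pd i w)) t)
    (fun _ _ => L2x_nonneg _ _) (Finset.mem_univ i)
  have h2 := Finset.single_le_sum (f := fun σ : Fin n → Fin 7 =>
    ∑ i : Fin 4, L2x (opIter ZField (List.ofFn σ) (pd i w)) t)
    (fun _ _ => Finset.sum_nonneg fun _ _ => L2x_nonneg _ _) (Finset.mem_univ σ)
  have h3 := Finset.single_le_sum (f := fun n => ∑ σ : Fin n → Fin 7,
    ∑ i : Fin 4, L2x (opIter ZField (List.ofFn σ) (pd i w)) t)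
    (fun _ _ => Finset.sum_nonneg fun _ _ => Finset.sum_nonneg fun _ _ => L2x_nonneg _ _)
    (Finset.mem_range.2 hn)
  exact h1.trans (h2.trans h3)

lemma L2x_pd_le_energySum (w : (Fin 4 → ℝ) → ℝ) (t : ℝ) (i : Fin 4) :
    L2x (pd i w) t ≤ energySum w t :=
  L2x_opIter_le_energySum w t (n := 0) (by norm_num) ![] i

lemma L2x_ZField_pd_le_energySum (w : (Fin 4 → ℝ) → ℝ) (t : ℝ) (m : Fin 7) (i : Fin 4) :
    L2x (ZField m (pd i w)) t ≤ energySum w t :=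
  L2x_opIter_le_energySum w t (n := 1) (by norm_num) ![m] i

lemma energySum_nonneg (w : (Fin 4 → ℝ) → ℝ) (t : ℝ) : 0 ≤ energySum w t :=
  (L2x_nonneg _ _).trans (L2x_pd_le_energySum w t 0)

lemma L2x_pd_pd_le_energySum (w : (Fin 4 → ℝ) → ℝ) (t : ℝ) (i j : Fin 4) :
    L2x (pd i (pd j w)) t ≤ energySum w t := by
  fin_cases i
  · exact L2x_ZField_pd_le_energySum w t 0 j
  · exact L2x_ZField_pd_le_energySum w t 1 j
  · exact L2x_ZField_pd_le_energySum w t 2 j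
  · exact L2x_ZField_pd_le_energySum w t 3 j

lemma L2x_pd_rotField_le_energySum {w : (Fin 4 → ℝ) → ℝ} (hw : IsTestFunction w) (t : ℝ)
    {m : Fin 7} {j k : Fin 4} (hm : ZField m = rotField j k) (i : Fin 4) :
    L2x (pd i (rotField j k w)) t ≤ 3 * energySum w t := by
  have h := L2x_le_add ((hw.rotField j k).pd i) ((hw.pd i).rotField j k) (hw.pd k) (hw.pd j)
    (abs_pd_rotField_le hw i j k) t
  have h1 := L2x_ZField_pd_le_energySum w t m i
  rw [hm] at h1
  linarith [L2x_pd_le_energySum w t k, L2x_pd_le_energySum w t j]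

lemma exists_abs_le_energySum :
    ∃ C : ℝ≥0, ∀ w : (Fin 4 → ℝ) → ℝ, IsTestFunction w → ∀ (t : ℝ) (x : Fin 3 → ℝ),
      |w (Fin.cons t x)| ≤ C * energySum w t := by
  obtain ⟨C, hC⟩ := exists_enorm_le_planar
  refine ⟨C * 12, fun w hw t x => ?_⟩
  have h := hC (fun x => w (Fin.cons t x)) (fun j x => pd j.succ w (Fin.cons t x))
    ((hw.slice t).contDiff.of_le (by simp)) (hw.slice t).hasCompactSupport
    (fun j => ((hw.pd j.succ).slice t).contDiff.of_le (by simp))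
    (fun j => ((hw.pd j.succ).slice t).hasCompactSupport)
    (fun j x => (fderiv_slice hw t x j).symm) x
  grw [eLpNorm_fderiv_slice_le hw (fun i => L2x_pd_le_energySum w t i.succ),
    Finset.sum_le_sum fun j _ => eLpNorm_fderiv_slice_le (hw.pd j.succ)
      (fun i => L2x_pd_pd_le_energySum w t i.succ j.succ)] at h
  have hE := energySum_nonneg w t
  rw [← Real.norm_eq_abs, ← ENNReal.ofReal_le_ofReal_iff (by positivity), ofReal_norm,
    ENNReal.ofReal_mul (by positivity), ENNReal.ofReal_coe_nnreal]
  refine h.trans (le_of_eq ?_)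
  simp only [Finset.sum_const, Finset.card_univ, Fintype.card_fin, nsmul_eq_mul]
  push_cast
  ring

lemma exists_sqrt_mul_abs_le_energySum :
    ∃ C : ℝ≥0, ∀ w : (Fin 4 → ℝ) → ℝ, IsTestFunction w → ∀ (t : ℝ) (x : Fin 3 → ℝ) (R : ℝ),
      0 < R → ∑ i, x i ^ 2 = R ^ 2 → √R * |w (Fin.cons t x)| ≤ C * energySum w t := by
  obtain ⟨C, hC⟩ := exists_enorm_le_spherical
  let c : ℝ := ((Real.cos 1)⁻¹) ^ (1 / 4 : ℝ)
  have hc0 : 0 < Real.cos 1 := Real.cos_one_pos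
  have hc : 0 ≤ c := by positivity
  refine ⟨C * c.toNNReal * 30, fun w hw t x R hR hx => ?_⟩
  let f : Fin 3 → (Fin 4 → ℝ) → ℝ := ![rotField 1 2 w, rotField 1 3 w, rotField 2 3 w]
  have hf : ∀ j, IsTestFunction (f j) := by
    intro j
    fin_cases j
    exacts [hw.rotField 1 2, hw.rotField 1 3, hw.rotField 2 3]
  have hfL : ∀ j, ∀ i : Fin 3, L2x (pd i.succ (f j)) t ≤ 3 * energySum w t := by
    intro j i
    fin_cases j
    · exact L2x_pd_rotField_le_energySum hw t (m := 4) rfl i.succ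
    · exact L2x_pd_rotField_le_energySum hw t (m := 5) rfl i.succ
    · exact L2x_pd_rotField_le_energySum hw t (m := 6) rfl i.succ
  have h := hC (fun x => w (Fin.cons t x)) (fun j x => f j (Fin.cons t x))
    ((hw.slice t).contDiff.of_le (by simp)) (hw.slice t).hasCompactSupport
    (fun j => ((hf j).slice t).contDiff.of_le (by simp))
    (fun j => ((hf j).slice t).hasCompactSupport)
    (fun x => by rw [fderiv_slice hw, fderiv_slice hw]; rfl)
    (fun x => by rw [fderiv_slice hw, fderiv_slice hw]; rfl)
    (fun x => by rw [fderiv_slice hw, fderiv_slice hw]; rfl) x R hR hx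
  grw [eLpNorm_fderiv_slice_le hw (fun i => L2x_pd_le_energySum w t i.succ),
    Finset.sum_le_sum fun j _ => eLpNorm_fderiv_slice_le (hf j) (hfL j)] at h
  have hE := energySum_nonneg w t
  have hK : ((R ^ 2 * Real.cos 1)⁻¹) ^ (1 / 4 : ℝ) = (√R)⁻¹ * c := by
    rw [mul_inv, Real.mul_rpow (by positivity) (by positivity), Real.inv_rpow (by positivity),
      ← Real.rpow_natCast, ← Real.rpow_mul hR.le, Real.sqrt_eq_rpow]
    norm_num [c]
  have hle : |w (Fin.cons t x)| ≤ C * ((√R)⁻¹ * c) * (30 * energySum w t) := by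
    rw [← Real.norm_eq_abs, ← ENNReal.ofReal_le_ofReal_iff (by positivity), ofReal_norm,
      ENNReal.ofReal_mul (by positivity), ENNReal.ofReal_mul (by positivity),
      ENNReal.ofReal_coe_nnreal, ENNReal.ofReal_mul (by positivity) (p := 30), ← hK,
      ← ENNReal.ofReal_rpow_of_pos (by positivity)]
    refine h.trans (le_of_eq ?_)
    simp only [Finset.sum_const, Finset.card_univ, Fintype.card_fin, nsmul_eq_mul]
    rw [ENNReal.ofReal_mul (by norm_num)]
    push_cast
    simp only [ENNReal.ofReal_ofNat]
    ring
  have hsR : 0 < √R := Real.sqrt_pos.2 hR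
  calc √R * |w (Fin.cons t x)| ≤ √R * (C * ((√R)⁻¹ * c) * (30 * energySum w t)) := by gcongr
    _ = _ := by
      push_cast
      rw [Real.coe_toNNReal _ hc]
      field_simp

end WeightedSobolev

/-- weighted Sobolev estimate: there is a constant `C` such that for every
`w ∈ C₀^∞(ℝ₊×ℝ³)`, every `t ≥ 0` and every `x ∈ ℝ³`,
`⟨r⟩^{1/2} |w(t,x)| ≤ C Σ_{|α|≤1} ‖Z^α ∂w(t,·)‖_{L²(ℝ³)}`. -/
theorem stmt2 :
    ∃ C : ℝ, 0 < C ∧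
      ∀ w : (Fin 4 → ℝ) → ℝ, ContDiff ℝ (⊤ : ℕ∞) w → HasCompactSupport w →
        ∀ t : ℝ, 0 ≤ t → ∀ x : Fin 3 → ℝ,
          Real.sqrt (Real.sqrt (1 + ((x 0)^2 + (x 1)^2 + (x 2)^2))) * |w (Fin.cons t x)| ≤
            C * ∑ n ∈ Finset.range 2, ∑ σ : Fin n → Fin 7, ∑ i : Fin 4,
              L2x (opIter ZField (List.ofFn σ) (pd i w)) t := by
  obtain ⟨C₁, h₁⟩ := exists_abs_le_energySum
  obtain ⟨C₂, h₂⟩ := exists_sqrt_mul_abs_le_energySum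
  refine ⟨C₁ + C₂ + 1, by positivity, fun w hw hwc t _ x => ?_⟩
  change _ ≤ _ * energySum w t
  have hE := energySum_nonneg w t
  set R := √((x 0) ^ 2 + (x 1) ^ 2 + (x 2) ^ 2) with hRdef
  have hR2 : R ^ 2 = (x 0) ^ 2 + (x 1) ^ 2 + (x 2) ^ 2 := Real.sq_sqrt (by positivity)
  have hR0 : 0 ≤ R := Real.sqrt_nonneg _
  have hweight : √(√(1 + R ^ 2)) ≤ 1 + √R := by
    refine Real.sqrt_le_iff.2 ⟨by positivity, Real.sqrt_le_iff.2 ⟨by positivity, ?_⟩⟩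
    nlinarith [Real.sq_sqrt hR0, Real.sqrt_nonneg R, mul_nonneg hR0 (Real.sqrt_nonneg R)]
  have hfar : √R * |w (Fin.cons t x)| ≤ C₂ * energySum w t := by
    rcases hR0.eq_or_lt with h | h
    · rw [← h, Real.sqrt_zero, zero_mul]
      positivity
    · exact h₂ w ⟨hw, hwc⟩ t x R h (by rw [hR2, Fin.sum_univ_three])
  rw [← hR2]
  calc √(√(1 + R ^ 2)) * |w (Fin.cons t x)| ≤ (1 + √R) * |w (Fin.cons t x)| := by gcongr
    _ = |w (Fin.cons t x)| + √R * |w (Fin.cons t x)| := by ring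
    _ ≤ C₁ * energySum w t + C₂ * energySum w t := add_le_add (h₁ w ⟨hw, hwc⟩ t x) hfar
    _ ≤ _ := by linarith
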